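/- Let μ be a translation-invariant probability measure on (Ω,F) with π(0) ∈ L¹(μ). For each v ∈ C_b(Ω,ℝ^d), the quantity ⟨v, c v⟩_{L²(μ,ℝ^d)} := Σ_{i=1}^d ∫ c_{ω'}(0,e_i) v_i(ω')² μ(dω') is finite, and with f ∈ C_b(Ω) defined by f(ω) := π_ω(0)^{-1} (∇*(c v))(ω), one has ⟨f,(−L)^{-1}f⟩_{L²(πμ)} ≤ ⟨v, c v⟩_{L²(μ,ℝ^d)}. -/

import Mathlib

open MeasureTheory Filter Topology Matrix
open scoped ENNReal NNReal

noncomputable section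

namespace DetCond

/-- Vertices of `ℤ^d`. -/
abbrev Vert (d : ℕ) := Fin d → ℤ

/-- Index of the (unordered) nearest-neighbour edge `(x, x + e i)` of `ℤ^d`;
the set of these indices is in natural bijection with `E(ℤ^d)` modulo orientation. -/
abbrev EdgeIx (d : ℕ) := Vert d × Fin d

/-- The space `Ω = (0,∞)^{E(ℤ^d)}` of (symmetric) conductance configurations, with
its product topology and product σ-algebra. -/
abbrev EnvSp (d : ℕ) := {ω : EdgeIx d → ℝ // ∀ e, 0 < ω e}

/-- The `i`-th coordinate unit vector of `ℤ^d`. -/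
def unitv (d : ℕ) (i : Fin d) : Vert d := fun j => if j = i then 1 else 0

/-- The translation `τ_x` acting on environments: `c_{τ_x ω}(y,z) = c_ω(y+x,z+x)`. -/
def shift (d : ℕ) (x : Vert d) (ω : EnvSp d) : EnvSp d :=
  ⟨fun e => ω.1 (e.1 + x, e.2), fun e => ω.2 (e.1 + x, e.2)⟩

/-- The conductance `c_ω(x,y)`; it vanishes when `x,y` are not nearest neighbours
and is symmetric in `x,y` by construction. -/
def cnd (d : ℕ) (ω : EnvSp d) (x y : Vert d) : ℝ :=
  ∑ i, ((if y = x + unitv d i then ω.1 (x, i) else 0) +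
        (if x = y + unitv d i then ω.1 (y, i) else 0))

/-- `π_ω(x) = Σ_{z : (x,z) ∈ E(ℤ^d)} c_ω(x,z)`. -/
def piOf (d : ℕ) (ω : EnvSp d) (x : Vert d) : ℝ :=
  ∑ i, (ω.1 (x, i) + ω.1 (x - unitv d i, i))

/-- The box `Λ_r = [-r,r]^d ∩ ℤ^d`. -/
def box (d : ℕ) (r : ℝ) : Finset (Vert d) :=
  Fintype.piFinset fun _ : Fin d => Finset.Icc ⌈-r⌉ ⌊r⌋

/-- The nearest neighbours of `x` in `ℤ^d`. -/
def nbrs (d : ℕ) (x : Vert d) : Finset (Vert d) :=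
  (Finset.univ.image fun i => x + unitv d i) ∪ (Finset.univ.image fun i => x - unitv d i)

/-- The set `E(Λ)` of edges incident with at least one vertex of `Λ`
(one index per unordered edge). -/
def edgesIn (d : ℕ) (Λ : Finset (Vert d)) : Finset (EdgeIx d) :=
  Λ.biUnion fun x =>
    (Finset.univ.image fun i => (x, i)) ∪ (Finset.univ.image fun i => (x - unitv d i, i))

/-- Bounded functions on `Ω`. -/
def IsBdd (d : ℕ) (f : EnvSp d → ℝ) : Prop := ∃ M, ∀ ω, |f ω| ≤ M

/-- Local functions: `f` depends only on the coordinates in some finite set `B` of edges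
and, viewed as a function of those coordinates, has compact support in `(0,∞)^B`. -/
def IsLocalFn (d : ℕ) (f : EnvSp d → ℝ) : Prop :=
  ∃ B : Finset (EdgeIx d),
    (∀ ω₁ ω₂ : EnvSp d, (∀ e ∈ B, ω₁.1 e = ω₂.1 e) → f ω₁ = f ω₂) ∧
    ∃ a b : ℝ, 0 < a ∧ ∀ ω : EnvSp d, (∃ e ∈ B, ω.1 e < a ∨ b < ω.1 e) → f ω = 0

/-- `ℓ_ω(f) = L`, i.e. the block averages of the translates of `f` converge to `L`. -/
def avgTo (d : ℕ) (ω : EnvSp d) (f : EnvSp d → ℝ) (L : ℝ) : Prop :=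
  Tendsto (fun n : ℕ => (∑ x ∈ box d (n : ℝ), f (shift d x ω)) / ((box d (n : ℝ)).card : ℝ))
    atTop (𝓝 L)

/-- `ω` is averaging: `ℓ_ω(f)` exists for every continuous local `f`. -/
def Averaging (d : ℕ) (ω : EnvSp d) : Prop :=
  ∀ f : EnvSp d → ℝ, Continuous f → IsLocalFn d f → ∃ L, avgTo d ω f L

/-- `ω` is tempered, i.e. `ω ∈ Ω'`. -/
def Tempered (d : ℕ) (ω : EnvSp d) : Prop :=
  Tendsto (fun ε : ℝ =>
      limsup (fun n : ℕ =>
        (∑ e ∈ edgesIn d (box d (n : ℝ)),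
            (if ε ≤ ω.1 e ∧ ω.1 e ≤ ε⁻¹ then (0:ℝ) else 1)) / (n : ℝ) ^ d) atTop)
    (𝓝[>] 0) (𝓝 0)

/-- `P` is the measure `ℙ_ω` associated with an averaging tempered `ω`:
the unique probability measure whose expectation of every bounded continuous function
is the corresponding block-average limit `ℓ_ω(f)`. -/
def IsEnvLaw (d : ℕ) (ω : EnvSp d) (P : Measure (EnvSp d)) : Prop :=
  IsProbabilityMeasure P ∧
    ∀ f : EnvSp d → ℝ, Continuous f → IsBdd d f → avgTo d ω f (∫ ω', f ω' ∂P)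

/-- Ergodicity of a measure on `Ω` with respect to the translations of `ℤ^d`. -/
def ErgodicEnv (d : ℕ) (P : Measure (EnvSp d)) : Prop :=
  ∀ A : Set (EnvSp d), MeasurableSet A → (∀ x : Vert d, shift d x ⁻¹' A = A) →
    P A = 0 ∨ P A = 1

/-- `ω ∈ Ω⋆`: tempered, averaging, and the associated measure `ℙ_ω` is ergodic. -/
def InOmegaStar (d : ℕ) (ω : EnvSp d) : Prop :=
  Tempered d ω ∧ Averaging d ω ∧
    ∀ P : Measure (EnvSp d), IsEnvLaw d ω P → ErgodicEnv d P

/-- `ω ∈ Ω_{p,q}`. -/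
def InOmegaPQ (d : ℕ) (p q : ℝ) (ω : EnvSp d) : Prop :=
  (∃ C : ℝ, ∀ n : ℕ, 1 ≤ n →
      (∑ e ∈ edgesIn d (box d (n : ℝ)), ω.1 e ^ p) / (n : ℝ) ^ d ≤ C) ∧
  (∃ C : ℝ, ∀ n : ℕ, 1 ≤ n →
      (∑ e ∈ edgesIn d (box d (n : ℝ)), ω.1 e ^ (-q)) / (n : ℝ) ^ d ≤ C)

/-- The path space of the discrete-time walk. -/
abbrev Path (d : ℕ) := ℕ → Vert d

/-- One-step transition probabilities `𝖯_ω(x,y) = c_ω(x,y)/π_ω(x)`. -/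
def transP (d : ℕ) (ω : EnvSp d) (x y : Vert d) : ℝ := cnd d ω x y / piOf d ω x

/-- `μ` is the law `P_ω^{x₀}` of the random walk among the conductances `ω`
started at `x₀`: a probability measure on the path space with the prescribed
finite-dimensional (cylinder) probabilities. -/
def IsWalkLaw (d : ℕ) (ω : EnvSp d) (x₀ : Vert d) (μ : Measure (Path d)) : Prop :=
  IsProbabilityMeasure μ ∧
    ∀ (n : ℕ) (γ : ℕ → Vert d),
      μ {w | ∀ k ≤ n, w k = γ k} =
        (if γ 0 = x₀ then 1 else 0) *
          ∏ k ∈ Finset.range n, ENNReal.ofReal (transP d ω (γ k) (γ (k+1)))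

/-- `n`-step transition probabilities of the discrete-time walk. -/
def stepP (d : ℕ) (ω : EnvSp d) : ℕ → Vert d → Vert d → ℝ
  | 0, x, y => if x = y then 1 else 0
  | n+1, x, y => ∑ z ∈ nbrs d x, transP d ω x z * stepP d ω n z y

/-- `P_ω^x(Y_t = y)` for the constant-speed continuous-time walk `Y_t = X_{N(t)}`,
where `N` is an independent rate-1 Poisson process. -/
def ctP (d : ℕ) (ω : EnvSp d) (t : ℝ) (x y : Vert d) : ℝ :=
  ∑' k : ℕ, Real.exp (-t) * t ^ k / (Nat.factorial k : ℝ) * stepP d ω k x y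

/-- The `ℓ¹`-norm of a vertex of `ℤ^d`. -/
def l1 (d : ℕ) (x : Vert d) : ℝ := ∑ i, |(x i : ℝ)|

/-- A vertex of `ℤ^d` regarded as a point of `ℝ^d`. -/
def ivert (d : ℕ) (x : Vert d) : Fin d → ℝ := fun i => (x i : ℝ)

/-- The linearly interpolated diffusively rescaled walk `B^{(n)}`. -/
def BnProc (d : ℕ) (n : ℕ) (w : Path d) (t : ℝ) : Fin d → ℝ :=
  (Real.sqrt n)⁻¹ •
    (ivert d (w ⌊t * n⌋₊) +
      (t * n - (⌊t * n⌋₊ : ℝ)) • (ivert d (w (⌊t * n⌋₊ + 1)) - ivert d (w ⌊t * n⌋₊)))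


/-- The measure `ℚ_ω` obtained from `ℙ_ω` by tilting with `π(0)`. -/
def Qmeas (d : ℕ) (P : Measure (EnvSp d)) : Measure (EnvSp d) :=
  P.withDensity fun ω' => ENNReal.ofReal (piOf d ω' 0 / ∫ ω'', piOf d ω'' 0 ∂P)

/-- The inner product `⟨f,g⟩_{L²(πμ)}`. -/
def innerP (d : ℕ) (P : Measure (EnvSp d)) (f g : EnvSp d → ℝ) : ℝ :=
  ∫ ω', f ω' * g ω' * piOf d ω' 0 ∂P

/-- The Dirichlet pairing `⟨h, (−L)h⟩_{L²(πμ)}`. -/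
def quadL (d : ℕ) (P : Measure (EnvSp d)) (h : EnvSp d → ℝ) : ℝ :=
  ∫ ω', (∑ z ∈ nbrs d 0, cnd d ω' 0 z * (h ω' - h (shift d z ω'))) * h ω' ∂P

/-- The inner product of `L²(ν)`. -/
def innerQ (d : ℕ) (ν : Measure (EnvSp d)) (f g : EnvSp d → ℝ) : ℝ :=
  ∫ ω', f ω' * g ω' ∂ν

/-- The Dirichlet pairing `⟨h, (−L)h⟩_{L²(ν)}`. -/
def quadQ (d : ℕ) (ν : Measure (EnvSp d)) (h : EnvSp d → ℝ) : ℝ :=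
  ∫ ω', ((piOf d ω' 0)⁻¹ *
      ∑ z ∈ nbrs d 0, cnd d ω' 0 z * (h ω' - h (shift d z ω'))) * h ω' ∂ν

/-- The set whose supremum is the variational characterization
`⟨f,(−L)⁻¹f⟩_{L²(ν)} = sup_h [2⟨h,f⟩ − ⟨h,(−L)h⟩]` (over bounded continuous `h`);
`⟨f,(−L)⁻¹f⟩_{L²(ν)} < ∞` means this set is bounded above. -/
def invPairSet (d : ℕ) (ν : Measure (EnvSp d)) (f : EnvSp d → ℝ) : Set ℝ :=
  {r | ∃ h : EnvSp d → ℝ, Continuous h ∧ IsBdd d h ∧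
        r = 2 * innerQ d ν h f - quadQ d ν h}

/-- The function `f(ω) = π_ω(0)⁻¹ ∇⋆(c v)(ω)` built from a vector field `v`. -/
def fDiv (d : ℕ) (v : EnvSp d → Fin d → ℝ) (ω : EnvSp d) : ℝ :=
  (piOf d ω 0)⁻¹ *
    ∑ i, (cnd d ω 0 (unitv d i) * v ω i -
          cnd d ω (-(unitv d i)) 0 * v (shift d (-(unitv d i)) ω) i)

/-- The inner product of `ℓ²(Λ,π_ω)`. -/
def innerF (d : ℕ) (ω : EnvSp d) (Λ : Finset (Vert d)) (f g : Vert d → ℝ) : ℝ :=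
  ∑ x ∈ Λ, f x * g x * piOf d ω x

/-- The pairing `⟨h, (−𝖫_ω)h⟩_{ℓ²(Λ,π_ω)}` for `h` vanishing outside `Λ`. -/
def quadF (d : ℕ) (ω : EnvSp d) (Λ : Finset (Vert d)) (h : Vert d → ℝ) : ℝ :=
  ∑ x ∈ Λ, (∑ z ∈ nbrs d x, cnd d ω x z * (h x - h z)) * h x

/-- `⟨f, (−𝖫_ω)⁻¹_Λ f⟩_{ℓ²(Λ,π_ω)}` via its variational characterization
`sup_h [2⟨h,f⟩ − ⟨h,(−𝖫_ω)h⟩]` over `h ∈ ℓ²(Λ,π_ω)`. -/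
def invPairF (d : ℕ) (ω : EnvSp d) (Λ : Finset (Vert d)) (f : Vert d → ℝ) : ℝ :=
  sSup {r | ∃ h : Vert d → ℝ, (∀ x ∉ Λ, h x = 0) ∧
      r = 2 * innerF d ω Λ h f - quadF d ω Λ h}

/-- The antisymmetric edge function `v∘τ(ω)`: the value assigned to the
edge `(x, x+e_i)` is `v_i(τ_x(ω))`. -/
def efield (d : ℕ) (v : EnvSp d → Fin d → ℝ) (ω : EnvSp d) : Vert d → Fin d → ℝ :=
  fun x i => v (shift d x ω) i

/-- The discrete gradient `∇h` of `h : ℤ^d → ℝ` as an edge function. -/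
def dgradE (d : ℕ) (h : Vert d → ℝ) : Vert d → Fin d → ℝ :=
  fun x i => h (x + unitv d i) - h x

/-- The inner product `⟨u,w⟩_{ℓ²(E(Λ), c_ω)}` of (antisymmetric) edge functions;
each unordered edge is counted once, which agrees with the paper's sum over
ordered edges carrying the factor ½. -/
def einner (d : ℕ) (ω : EnvSp d) (Λ : Finset (Vert d)) (u w : Vert d → Fin d → ℝ) : ℝ :=
  ∑ e ∈ edgesIn d Λ, u e.1 e.2 * w e.1 e.2 * ω.1 e

/-- The Dirichlet energy `𝓔_Λ^ω(v)`. -/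
def direnergy (d : ℕ) (ω : EnvSp d) (Λ : Finset (Vert d)) (v : EnvSp d → Fin d → ℝ) : ℝ :=
  sInf {r | ∃ h : Vert d → ℝ, (∀ x ∉ Λ, h x = 0) ∧
      r = einner d ω Λ (fun x i => efield d v ω x i - dgradE d h x i)
            (fun x i => efield d v ω x i - dgradE d h x i)}

/-- The gradient `∇h` of a function on `Ω`. -/
def gradOmega (d : ℕ) (h : EnvSp d → ℝ) : EnvSp d → Fin d → ℝ :=
  fun ω i => h (shift d (unitv d i) ω) - h ω

/-- The inner product `⟨u, c w⟩_{L²(P,ℝ^d)}`. -/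
def cinnerP (d : ℕ) (P : Measure (EnvSp d)) (u w : EnvSp d → Fin d → ℝ) : ℝ :=
  ∑ i, ∫ ω', cnd d ω' 0 (unitv d i) * u ω' i * w ω' i ∂P

/-- Bounded vector fields on `Ω`. -/
def IsBddV (d : ℕ) (v : EnvSp d → Fin d → ℝ) : Prop := ∃ M, ∀ ω i, |v ω i| ≤ M

/-- The space `𝒱 = (ℝ^d)^{ℤ^d}` of vector fields on `ℤ^d`. -/
abbrev VS (d : ℕ) := Vert d → Fin d → ℝ

/-- The empirical measures `μ_r^{ω,v}` built from the minimizers `h_r` of the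
finite-volume Dirichlet energies. -/
def muR (d : ℕ) (ω : EnvSp d) (hr : ℕ → Vert d → ℝ) (r : ℕ) :
    Measure (EnvSp d × VS d) :=
  (((box d ((r : ℝ) + Real.sqrt r)).card : ℝ≥0∞) *
      ((box d (Real.sqrt r)).card : ℝ≥0∞))⁻¹ •
    ∑ z ∈ box d (Real.sqrt r), ∑ x ∈ box d ((r : ℝ) + Real.sqrt r),
      Measure.dirac (shift d (x + z) ω, fun y => dgradE d (hr r) (x + z + y))

/-- The localized conductances `c_ω^R`. -/
def cR (d : ℕ) (ω : EnvSp d) (R : ℝ) (e : EdgeIx d) : ℝ :=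
  if e ∈ edgesIn d (box d (2 * R)) then ω.1 e else 1

/-- The localized measure `π_ω^R`. -/
def piRloc (d : ℕ) (ω : EnvSp d) (R : ℝ) (x : Vert d) : ℝ :=
  if x ∈ box d (2 * R) then piOf d ω x
  else if x ∈ box d (4 * R) then 1 + piOf d ω x else 1

/-- The localized Dirichlet form `D_ω^R(f,f)` (each unordered edge counted once). -/
def DR (d : ℕ) (ω : EnvSp d) (R : ℝ) (f : Vert d → ℝ) : ℝ≥0∞ :=
  ∑' e : EdgeIx d, ENNReal.ofReal (cR d ω R e * (f (e.1 + unitv d e.2) - f e.1) ^ 2)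

/-- The norm `‖f‖_{ℓ^s(μ)}`. -/
def lpN (d : ℕ) (μw : Vert d → ℝ) (s : ℝ) (f : Vert d → ℝ) : ℝ≥0∞ :=
  (∑' x : Vert d, ENNReal.ofReal (|f x| ^ s * μw x)) ^ (1 / s)

/-- The exponent `ε = 2(2/d − 1/p − 1/q)((d−2)/d + 1/q)⁻¹`. -/
def epsPQ (d : ℕ) (p q : ℝ) : ℝ :=
  2 * (2 / (d : ℝ) - 1 / p - 1 / q) / (((d : ℝ) - 2) / (d : ℝ) + 1 / q)

/-- Jump rates of the localized constant-speed chain `Y^R`: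
rate `c_ω^R(x,y)/π_ω^R(x)` from `x` to `y`. -/
def rateR (d : ℕ) (ω : EnvSp d) (R : ℝ) (x y : Vert d) : ℝ :=
  (∑ i, ((if y = x + unitv d i then cR d ω R (x, i) else 0) +
         (if x = y + unitv d i then cR d ω R (y, i) else 0))) / piRloc d ω R x

/-- The generator matrix of `Y^R`. -/
def qmatR (d : ℕ) (ω : EnvSp d) (R : ℝ) (x y : Vert d) : ℝ :=
  if x = y then -(∑ z ∈ nbrs d x, rateR d ω R x z) else rateR d ω R x y

/-- Iterates of the generator matrix of `Y^R`. -/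
def qiter (d : ℕ) (ω : EnvSp d) (R : ℝ) : ℕ → Vert d → Vert d → ℝ
  | 0, x, y => if x = y then 1 else 0
  | n+1, x, y => ∑ z ∈ insert x (nbrs d x), qmatR d ω R x z * qiter d ω R n z y

/-- The heat kernel `P_ω^x(Y_t^R = y) = (e^{tQ})(x,y)` of the localized chain `Y^R`. -/
def hkR (d : ℕ) (ω : EnvSp d) (R : ℝ) (t : ℝ) (x y : Vert d) : ℝ :=
  ∑' k : ℕ, t ^ k / (Nat.factorial k : ℝ) * qiter d ω R k x y

section KipnisVaradhan

variable {d : ℕ}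

lemma unitv_injective : Function.Injective (unitv d) := by
  intro i j hij
  by_contra hne
  have := congrFun hij i
  simp [unitv, hne] at this

lemma unitv_ne_neg_unitv (i j : Fin d) : unitv d i ≠ -unitv d j := by
  intro hij
  have := congrFun hij i
  by_cases h : i = j <;> simp [unitv, h] at this

lemma cnd_add_unitv (ω : EnvSp d) (x : Vert d) (i : Fin d) :
    cnd d ω x (x + unitv d i) = ω.1 (x, i) := by
  have h2 : ∀ j, ¬ x = x + unitv d i + unitv d j := by
    intro j hj
    rw [add_assoc, left_eq_add] at hj
    exact unitv_ne_neg_unitv i j (eq_neg_of_add_eq_zero_left hj)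
  simp [cnd, h2, unitv_injective.eq_iff]

lemma cnd_comm (ω : EnvSp d) (x y : Vert d) : cnd d ω x y = cnd d ω y x := by
  simp only [cnd, add_comm]

lemma cnd_zero_unitv (ω : EnvSp d) (i : Fin d) : cnd d ω 0 (unitv d i) = ω.1 (0, i) := by
  simpa using cnd_add_unitv ω 0 i

lemma cnd_neg_unitv_zero (ω : EnvSp d) (i : Fin d) :
    cnd d ω (-unitv d i) 0 = ω.1 (-unitv d i, i) := by
  simpa using cnd_add_unitv ω (-unitv d i) i

lemma sum_nbrs_zero (F : Vert d → ℝ) :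
    ∑ z ∈ nbrs d 0, F z = ∑ i, (F (unitv d i) + F (-unitv d i)) := by
  rw [nbrs, Finset.sum_union, Finset.sum_image, Finset.sum_image, Finset.sum_add_distrib]
  · simp
  · intro i _ j _ h
    exact unitv_injective (by simpa using h)
  · intro i _ j _ h
    exact unitv_injective (by simpa using h)
  · rw [Finset.disjoint_left]
    simp only [Finset.mem_image, Finset.mem_univ, true_and, zero_add, zero_sub]
    rintro _ ⟨i, rfl⟩ ⟨j, hj⟩
    exact unitv_ne_neg_unitv i j hj.symm

lemma continuous_shift (x : Vert d) : Continuous (shift d x) :=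
  Continuous.subtype_mk
    (continuous_pi fun e => (continuous_apply (e.1 + x, e.2)).comp continuous_subtype_val) _

lemma continuous_conductance (e : EdgeIx d) : Continuous fun ω : EnvSp d => ω.1 e :=
  (continuous_apply e).comp continuous_subtype_val

lemma shift_unitv_shift_neg_unitv (ω : EnvSp d) (i : Fin d) :
    shift d (unitv d i) (shift d (-unitv d i) ω) = ω := by
  apply Subtype.ext
  funext e
  simp [shift]

lemma conductance_le_piOf (ω : EnvSp d) (i : Fin d) : ω.1 (0, i) ≤ piOf d ω 0 := by
  have h := Finset.single_le_sum (f := fun i => ω.1 (0, i) + ω.1 (0 - unitv d i, i))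
    (fun j _ => (add_pos (ω.2 _) (ω.2 _)).le) (Finset.mem_univ i)
  have := ω.2 (0 - unitv d i, i)
  simp only [piOf]
  linarith

lemma piOf_pos (hd : 1 ≤ d) (ω : EnvSp d) (x : Vert d) : 0 < piOf d ω x :=
  Finset.sum_pos (fun _ _ => add_pos (ω.2 _) (ω.2 _)) ⟨⟨0, hd⟩, Finset.mem_univ _⟩

lemma integrable_conductance_mul {Pm : Measure (EnvSp d)}
    (hπ : Integrable (fun ω => piOf d ω 0) Pm) (i : Fin d) {g : EnvSp d → ℝ}
    (hg : Continuous g) (hgb : IsBdd d g) : Integrable (fun ω => ω.1 (0, i) * g ω) Pm := by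
  obtain ⟨M, hM⟩ := hgb
  have hc : Integrable (fun ω : EnvSp d => ω.1 (0, i)) Pm := by
    refine hπ.mono (continuous_conductance _).aestronglyMeasurable (ae_of_all _ fun ω => ?_)
    rw [Real.norm_of_nonneg (ω.2 _).le]
    exact (conductance_le_piOf ω i).trans (le_abs_self _)
  exact hc.mul_bdd (c := M) hg.aestronglyMeasurable (ae_of_all _ hM)

lemma integral_comp_shift {Pm : Measure (EnvSp d)} (hinv : ∀ x : Vert d, Pm.map (shift d x) = Pm)
    (x : Vert d) {F : EnvSp d → ℝ} (hF : Continuous F) :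
    ∫ ω, F (shift d x ω) ∂Pm = ∫ ω, F ω ∂Pm := by
  conv_rhs => rw [← hinv x]
  exact (integral_map (continuous_shift x).aemeasurable hF.aestronglyMeasurable).symm

lemma integrable_comp_shift {Pm : Measure (EnvSp d)}
    (hinv : ∀ x : Vert d, Pm.map (shift d x) = Pm) (x : Vert d) {F : EnvSp d → ℝ}
    (hF : Integrable F Pm) : Integrable (fun ω => F (shift d x ω)) Pm :=
  Integrable.comp_measurable (by rwa [hinv x]) (continuous_shift x).measurable

lemma IsBdd.mul {f g : EnvSp d → ℝ} (hf : IsBdd d f) (hg : IsBdd d g) :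
    IsBdd d fun ω => f ω * g ω := by
  obtain ⟨M, hM⟩ := hf
  obtain ⟨N, hN⟩ := hg
  refine ⟨M * N, fun ω => ?_⟩
  rw [abs_mul]
  exact mul_le_mul (hM ω) (hN ω) (abs_nonneg _) ((abs_nonneg _).trans (hM ω))

lemma IsBdd.sub {f g : EnvSp d → ℝ} (hf : IsBdd d f) (hg : IsBdd d g) :
    IsBdd d fun ω => f ω - g ω := by
  obtain ⟨M, hM⟩ := hf
  obtain ⟨N, hN⟩ := hg
  exact ⟨M + N, fun ω => (abs_sub _ _).trans (add_le_add (hM ω) (hN ω))⟩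

lemma IsBdd.comp_shift {f : EnvSp d → ℝ} (hf : IsBdd d f) (x : Vert d) :
    IsBdd d fun ω => f (shift d x ω) :=
  let ⟨M, hM⟩ := hf
  ⟨M, fun _ => hM _⟩

lemma IsBddV.apply {v : EnvSp d → Fin d → ℝ} (hv : IsBddV d v) (i : Fin d) :
    IsBdd d fun ω => v ω i :=
  let ⟨M, hM⟩ := hv
  ⟨M, fun ω => hM ω i⟩

/-- A function on environments has the integral of `∑ i, (A i - B i)` if it is the sum of the
`A i` minus the sum of the translates of the `B i` by `-e i`. -/
lemma integral_eq_sum_integral_sub {Pm : Measure (EnvSp d)}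
    (hinv : ∀ x : Vert d, Pm.map (shift d x) = Pm) {F : EnvSp d → ℝ} {A B : Fin d → EnvSp d → ℝ}
    (hA : ∀ i, Integrable (A i) Pm) (hB : ∀ i, Integrable (B i) Pm) (hBc : ∀ i, Continuous (B i))
    (hF : ∀ ω, F ω = ∑ i, (A i ω - B i (shift d (-unitv d i) ω))) :
    ∫ ω, F ω ∂Pm = ∑ i, ∫ ω, (A i ω - B i ω) ∂Pm := by
  have hBs := fun i => integrable_comp_shift hinv (-unitv d i) (hB i)
  rw [integral_congr_ae (ae_of_all _ hF)]
  refine (integral_finsetSum _ fun i _ => (hA i).sub (hBs i)).trans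
    (Finset.sum_congr rfl fun i _ => ?_)
  rw [integral_sub (hA i) (hB i), ← integral_comp_shift hinv (-unitv d i) (hBc i)]
  exact integral_sub (hA i) (hBs i)

/-- Summation by parts: `∇⋆` is adjoint to `-∇` under a translation-invariant measure. -/
lemma innerP_fDiv (hd : 1 ≤ d) {Pm : Measure (EnvSp d)}
    (hinv : ∀ x : Vert d, Pm.map (shift d x) = Pm)
    (hπ : Integrable (fun ω => piOf d ω 0) Pm)
    {v : EnvSp d → Fin d → ℝ} (hv : Continuous v) (hvb : IsBddV d v)
    {h : EnvSp d → ℝ} (hh : Continuous h) (hb : IsBdd d h) :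
    innerP d Pm h (fDiv d v) =
      ∑ i, ∫ ω, ω.1 (0, i) * ((h ω - h (shift d (unitv d i) ω)) * v ω i) ∂Pm := by
  have hvc : ∀ i, Continuous fun ω => v ω i := fun i => (continuous_apply i).comp hv
  have hhc : ∀ i, Continuous fun ω => h (shift d (unitv d i) ω) :=
    fun i => hh.comp (continuous_shift _)
  refine (integral_eq_sum_integral_sub hinv
    (A := fun i ω => ω.1 (0, i) * (h ω * v ω i))
    (B := fun i ω => ω.1 (0, i) * (h (shift d (unitv d i) ω) * v ω i))
    (fun i => integrable_conductance_mul hπ i (hh.mul (hvc i)) (hb.mul (hvb.apply i)))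
    (fun i => integrable_conductance_mul hπ i ((hhc i).mul (hvc i))
      ((hb.comp_shift _).mul (hvb.apply i)))
    (fun i => (continuous_conductance _).mul ((hhc i).mul (hvc i))) fun ω => ?_).trans
    (Finset.sum_congr rfl fun i _ => integral_congr_ae (ae_of_all _ fun ω => by ring))
  have hp := (piOf_pos hd ω 0).ne'
  rw [fDiv, mul_assoc, mul_right_comm, inv_mul_cancel₀ hp, one_mul, Finset.mul_sum]
  refine Finset.sum_congr rfl fun i _ => ?_
  simp only [shift_unitv_shift_neg_unitv, cnd_zero_unitv, cnd_neg_unitv_zero]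
  simp only [shift, zero_add]
  ring

/-- The Dirichlet form of a bounded continuous function. -/
lemma quadL_eq_sum_integral_sq {Pm : Measure (EnvSp d)}
    (hinv : ∀ x : Vert d, Pm.map (shift d x) = Pm)
    (hπ : Integrable (fun ω => piOf d ω 0) Pm)
    {h : EnvSp d → ℝ} (hh : Continuous h) (hb : IsBdd d h) :
    quadL d Pm h =
      ∑ i, ∫ ω, ω.1 (0, i) * ((h ω - h (shift d (unitv d i) ω)) *
        (h ω - h (shift d (unitv d i) ω))) ∂Pm := by
  have hhc : ∀ i, Continuous fun ω => h (shift d (unitv d i) ω) :=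
    fun i => hh.comp (continuous_shift _)
  refine (integral_eq_sum_integral_sub hinv
    (A := fun i ω => ω.1 (0, i) * ((h ω - h (shift d (unitv d i) ω)) * h ω))
    (B := fun i ω => ω.1 (0, i) *
      ((h ω - h (shift d (unitv d i) ω)) * h (shift d (unitv d i) ω)))
    (fun i => integrable_conductance_mul hπ i ((hh.sub (hhc i)).mul hh)
      ((hb.sub (hb.comp_shift _)).mul hb))
    (fun i => integrable_conductance_mul hπ i ((hh.sub (hhc i)).mul (hhc i))
      ((hb.sub (hb.comp_shift _)).mul (hb.comp_shift _)))
    (fun i => (continuous_conductance _).mul ((hh.sub (hhc i)).mul (hhc i))) fun ω => ?_).trans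
    (Finset.sum_congr rfl fun i _ => integral_congr_ae (ae_of_all _ fun ω => by ring))
  rw [sum_nbrs_zero, Finset.sum_mul]
  refine Finset.sum_congr rfl fun i _ => ?_
  simp only [shift_unitv_shift_neg_unitv, cnd_zero_unitv, cnd_comm ω 0 (-unitv d i),
    cnd_neg_unitv_zero]
  simp only [shift, zero_add]
  ring

end KipnisVaradhan

/-- STATEMENT 13 (Lemma 5.2): the Kipnis–Varadhan bound. -/
theorem statement13 (d : ℕ) (hd : 1 ≤ d) (Pm : Measure (EnvSp d))
    (hprob : IsProbabilityMeasure Pm) (hinv : ∀ x : Vert d, Pm.map (shift d x) = Pm)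
    (hπ : Integrable (fun ω' => piOf d ω' 0) Pm)
    (v : EnvSp d → Fin d → ℝ) (hv : Continuous v) (hvb : IsBddV d v) :
    (∀ i : Fin d, Integrable (fun ω' => cnd d ω' 0 (unitv d i) * v ω' i ^ 2) Pm) ∧
    ∀ h : EnvSp d → ℝ, Continuous h → IsBdd d h →
      2 * innerP d Pm h (fDiv d v) - quadL d Pm h ≤
        ∑ i, ∫ ω', cnd d ω' 0 (unitv d i) * v ω' i ^ 2 ∂Pm := by
  have hvc : ∀ i, Continuous fun ω => v ω i := fun i => (continuous_apply i).comp hv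
  have hV : ∀ i, Integrable (fun ω : EnvSp d => ω.1 (0, i) * v ω i ^ 2) Pm := fun i => by
    simp only [sq]
    exact integrable_conductance_mul hπ i ((hvc i).mul (hvc i))
      ((hvb.apply i).mul (hvb.apply i))
  simp only [cnd_zero_unitv]
  refine ⟨hV, fun h hh hb => ?_⟩
  have hgc : ∀ i, Continuous fun ω => h ω - h (shift d (unitv d i) ω) :=
    fun i => hh.sub (hh.comp (continuous_shift _))
  have hgb : ∀ i, IsBdd d fun ω => h ω - h (shift d (unitv d i) ω) :=
    fun i => hb.sub (hb.comp_shift _)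
  rw [innerP_fDiv hd hinv hπ hv hvb hh hb, quadL_eq_sum_integral_sq hinv hπ hh hb,
    Finset.mul_sum, ← Finset.sum_sub_distrib]
  refine Finset.sum_le_sum fun i _ => ?_
  have h1 : Integrable
      (fun ω => ω.1 (0, i) * ((h ω - h (shift d (unitv d i) ω)) * v ω i)) Pm :=
    integrable_conductance_mul hπ i ((hgc i).mul (hvc i)) ((hgb i).mul (hvb.apply i))
  have h2 : Integrable (fun ω => ω.1 (0, i) * ((h ω - h (shift d (unitv d i) ω)) *
      (h ω - h (shift d (unitv d i) ω)))) Pm :=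
    integrable_conductance_mul hπ i ((hgc i).mul (hgc i)) ((hgb i).mul (hgb i))
  rw [← integral_const_mul, ← integral_sub (h1.const_mul 2) h2]
  refine integral_mono ((h1.const_mul 2).sub h2) (hV i) fun ω => ?_
  have := mul_nonneg (ω.2 (0, i)).le (sq_nonneg (h ω - h (shift d (unitv d i) ω) - v ω i))
  simp only
  linarith


end DetCond
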